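/- arXiv:2406.03954 — 3 statements merged into one kernel-verified Lean document; each statement's English description precedes it below -/
import Mathlib

section
/- Let p be a positive integer, Σ and Q be p × p real symmetric positive definite matrices, c > 0 and z ≥ 0. Then the equation s = (c/p)·tr[Σ·(Σ/(1+s) + Q + z·Σ)^{-1}] has a unique solution s > 0, and this solution satisfies s ≤ c·(tr(Σ)/p)/λ_min(Q), where λ_min(Q) denotes the smallest eigenvalue of Q. -/
open Matrix Filter

/-- The smallest eigenvalue of a Hermitian real matrix. -/
noncomputable def lambdaMin {m : ℕ} {A : Matrix (Fin m) (Fin m) ℝ}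
    (hA : A.IsHermitian) : ℝ :=
  ⨅ i, hA.eigenvalues i

section

open scoped MatrixOrder

variable {n : Type*} [Fintype n] [DecidableEq n]

theorem Matrix.IsHermitian.eq_mul_diagonal_mul_conjTranspose {A : Matrix n n ℝ}
    (hA : A.IsHermitian) :
    A = (hA.eigenvectorUnitary : Matrix n n ℝ) * diagonal hA.eigenvalues *
      (hA.eigenvectorUnitary : Matrix n n ℝ)ᴴ := by
  conv_lhs => rw [hA.spectral_theorem, Unitary.conjStarAlgAut_apply]
  rfl

/-- Two positive definite matrices are simultaneously diagonalized by a congruence that takes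
the first one to the identity. -/
theorem Matrix.PosDef.exists_simultaneous_diagonalization {S Q : Matrix n n ℝ}
    (hS : S.PosDef) (hQ : Q.PosDef) :
    ∃ (P : Matrix n n ℝ) (d : n → ℝ), IsUnit P ∧ (∀ i, 0 < d i) ∧
      S = P * Pᴴ ∧ Q = P * diagonal d * Pᴴ := by
  obtain ⟨B, hB⟩ := CStarAlgebra.nonneg_iff_eq_star_mul_self.mp hS.posSemidef.nonneg
  rw [star_eq_conjTranspose] at hB
  have hBu : IsUnit B := by
    have hdet := hS.det_pos.ne'
    rw [hB, det_mul] at hdet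
    exact (isUnit_iff_isUnit_det B).2 (isUnit_iff_ne_zero.2 (right_ne_zero_of_mul hdet))
  have hBd : IsUnit B.det := (isUnit_iff_isUnit_det B).1 hBu
  have hBh : IsUnit Bᴴ.det := by rw [det_conjTranspose]; exact hBd.star
  have hA : ((B⁻¹)ᴴ * Q * B⁻¹).PosDef :=
    (IsUnit.posDef_star_left_conjugate_iff (isUnit_nonsing_inv_iff.2 hBu)).2 hQ
  have hV := hA.1.eq_mul_diagonal_mul_conjTranspose
  set V : Matrix n n ℝ := (hA.1.eigenvectorUnitary : Matrix n n ℝ)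
  have hVV : V * Vᴴ = 1 := Unitary.coe_mul_star_self hA.1.eigenvectorUnitary
  refine ⟨Bᴴ * V, hA.1.eigenvalues, ?_, hA.eigenvalues_pos, ?_, ?_⟩
  · exact ((isUnit_iff_isUnit_det _).2 hBh).mul
      ((isUnit_iff_isUnit_det _).2 (isUnit_det_of_right_inverse hVV))
  · rw [conjTranspose_mul, conjTranspose_conjTranspose, Matrix.mul_assoc, ← Matrix.mul_assoc V,
      hVV, Matrix.one_mul, hB]
  · calc Q = Bᴴ * ((B⁻¹)ᴴ * Q * B⁻¹) * B := by
          rw [conjTranspose_nonsing_inv, Matrix.mul_assoc, Matrix.mul_assoc, Matrix.mul_assoc,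
            nonsing_inv_mul _ hBd, Matrix.mul_one, mul_nonsing_inv_cancel_left _ _ hBh]
      _ = Bᴴ * (V * diagonal hA.1.eigenvalues * Vᴴ) * B := congrArg (fun X => Bᴴ * X * B) hV
      _ = Bᴴ * V * diagonal hA.1.eigenvalues * (Bᴴ * V)ᴴ := by
          simp only [conjTranspose_mul, conjTranspose_conjTranspose, Matrix.mul_assoc]

theorem Matrix.trace_mul_inv_mul_diagonal_mul_conjTranspose (P : Matrix n n ℝ)
    {d : n → ℝ} (hd : ∀ i, d i ≠ 0) (S : Matrix n n ℝ) :
    (S * (P * diagonal d * Pᴴ)⁻¹).trace = ∑ i, (P⁻¹ * S * P⁻¹ᴴ) i i * (d i)⁻¹ := by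
  have hinv : (diagonal d)⁻¹ = diagonal fun i => (d i)⁻¹ := by
    apply inv_eq_right_inv
    rw [diagonal_mul_diagonal, ← diagonal_one]
    congr 1
    ext i
    exact mul_inv_cancel₀ (hd i)
  rw [mul_inv_rev, mul_inv_rev, hinv, ← conjTranspose_nonsing_inv, ← Matrix.mul_assoc,
    ← Matrix.mul_assoc, trace_mul_comm, ← Matrix.mul_assoc, ← Matrix.mul_assoc]
  simp only [trace, diag_apply, mul_diagonal]

theorem Matrix.PosDef.exists_trace_mul_inv_eq_sum {S Q : Matrix n n ℝ}
    (hS : S.PosDef) (hQ : Q.PosDef) :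
    ∃ d : n → ℝ, (∀ i, 0 < d i) ∧
      ∀ a : ℝ, 0 ≤ a → (S * (a • S + Q)⁻¹).trace = ∑ i, (a + d i)⁻¹ := by
  obtain ⟨P, d, hP, hd, rfl, rfl⟩ := hS.exists_simultaneous_diagonalization hQ
  refine ⟨d, hd, fun a ha => ?_⟩
  have hPd : IsUnit P.det := (isUnit_iff_isUnit_det P).1 hP
  have hsum : a • (P * Pᴴ) + P * diagonal d * Pᴴ = P * diagonal (fun i => a + d i) * Pᴴ := by
    have : diagonal (fun i => a + d i) = a • (1 : Matrix n n ℝ) + diagonal d := by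
      rw [smul_one_eq_diagonal, diagonal_add]
    rw [this, Matrix.mul_add, Matrix.add_mul]
    simp
  have hone : P⁻¹ * (P * Pᴴ) * P⁻¹ᴴ = 1 := by
    rw [nonsing_inv_mul_cancel_left _ _ hPd, ← conjTranspose_mul, nonsing_inv_mul _ hPd,
      conjTranspose_one]
  rw [hsum, trace_mul_inv_mul_diagonal_mul_conjTranspose P
    (fun i => (add_pos_of_nonneg_of_pos ha (hd i)).ne'), hone]
  simp

end

theorem Matrix.PosSemidef.trace_mul_inv_le {m : ℕ} {S Q : Matrix (Fin m) (Fin m) ℝ}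
    (hS : S.PosSemidef) (hQ : Q.PosDef) :
    (S * Q⁻¹).trace ≤ S.trace / lambdaMin hQ.1 := by
  rcases isEmpty_or_nonempty (Fin m) with h | h
  · simp [trace]
  have hle : ∀ i, lambdaMin hQ.1 ≤ hQ.1.eigenvalues i :=
    fun i => ciInf_le (Set.finite_range _).bddBelow i
  have hpos : 0 < lambdaMin hQ.1 := by
    obtain ⟨i, hi⟩ := exists_eq_ciInf_of_finite (f := hQ.1.eigenvalues)
    rw [lambdaMin, ← hi]
    exact hQ.eigenvalues_pos i
  have hU := hQ.1.eq_mul_diagonal_mul_conjTranspose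
  set U : Matrix (Fin m) (Fin m) ℝ := (hQ.1.eigenvectorUnitary : Matrix (Fin m) (Fin m) ℝ)
  have hUU : U * Uᴴ = 1 := Unitary.coe_mul_star_self hQ.1.eigenvectorUnitary
  have hinv : U⁻¹ = Uᴴ := inv_eq_right_inv hUU
  have hpsd : (Uᴴ * S * U).PosSemidef := hS.conjTranspose_mul_mul_same U
  have htr : (Uᴴ * S * U).trace = S.trace := by
    rw [trace_mul_comm, ← Matrix.mul_assoc, hUU, Matrix.one_mul]
  have hQi : (S * Q⁻¹).trace = ∑ i, (Uᴴ * S * U) i i * (hQ.1.eigenvalues i)⁻¹ := by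
    conv_lhs => rw [hU]
    rw [trace_mul_inv_mul_diagonal_mul_conjTranspose U
      (fun i => (hQ.eigenvalues_pos i).ne'), hinv, conjTranspose_conjTranspose]
  rw [hQi, ← htr, div_eq_mul_inv, trace, Finset.sum_mul]
  refine Finset.sum_le_sum fun i _ => mul_le_mul_of_nonneg_left ?_ hpsd.diag_nonneg
  exact inv_anti₀ hpos (hle i)

theorem existsUnique_pos_eq_mul_sum_inv {ι : Type*} [Fintype ι] [Nonempty ι] {d : ι → ℝ}
    (hd : ∀ i, 0 < d i) {k : ℝ} (hk : 0 < k) :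
    ∃! s : ℝ, 0 < s ∧ s = k * ∑ i, ((1 + s)⁻¹ + d i)⁻¹ := by
  have hpos : ∀ s : ℝ, 0 ≤ s → ∀ i, 0 < (1 + s)⁻¹ + d i :=
    fun s hs i => add_pos (by positivity) (hd i)
  have hsum : ∀ s : ℝ, 0 ≤ s → 0 < k * ∑ i, ((1 + s)⁻¹ + d i)⁻¹ := fun s hs =>
    mul_pos hk (Finset.sum_pos (fun i _ => inv_pos.2 (hpos s hs i)) Finset.univ_nonempty)
  have hlt : ∀ s t : ℝ, 0 < s → s < t → s = k * ∑ i, ((1 + s)⁻¹ + d i)⁻¹ →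
      t ≠ k * ∑ i, ((1 + t)⁻¹ + d i)⁻¹ := by
    intro s t hs hst hfs hft
    have h1 : 1 = k * ∑ i, (s * ((1 + s)⁻¹ + d i))⁻¹ := by
      simp only [mul_inv, ← Finset.mul_sum]
      rw [mul_left_comm, ← hfs, inv_mul_cancel₀ hs.ne']
    have h2 : 1 = k * ∑ i, (t * ((1 + t)⁻¹ + d i))⁻¹ := by
      simp only [mul_inv, ← Finset.mul_sum]
      rw [mul_left_comm, ← hft, inv_mul_cancel₀ (hs.trans hst).ne']
    have h3 : ∑ i, (t * ((1 + t)⁻¹ + d i))⁻¹ < ∑ i, (s * ((1 + s)⁻¹ + d i))⁻¹ := by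
      refine Finset.sum_lt_sum_of_nonempty Finset.univ_nonempty fun i _ => ?_
      refine inv_strictAnti₀ (mul_pos hs (hpos s hs.le i)) ?_
      have h4 : s * (1 + s)⁻¹ < t * (1 + t)⁻¹ := by
        rw [← div_eq_mul_inv, ← div_eq_mul_inv, div_lt_div_iff₀ (by linarith) (by linarith)]
        linarith
      have h5 := mul_lt_mul_of_pos_right hst (hd i)
      linarith
    exact absurd (mul_lt_mul_of_pos_left h3 hk) (by rw [← h1, ← h2]; exact lt_irrefl 1)
  set M : ℝ := k * ∑ i, (d i)⁻¹ with hM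
  have hM0 : 0 ≤ M := mul_nonneg hk.le (Finset.sum_nonneg fun i _ => (inv_pos.2 (hd i)).le)
  have hcont : ContinuousOn (fun s : ℝ => s - k * ∑ i, ((1 + s)⁻¹ + d i)⁻¹) (Set.Icc 0 M) := by
    refine continuousOn_id.sub (continuousOn_const.mul (continuousOn_finsetSum _ fun i _ => ?_))
    refine ContinuousOn.inv₀ (ContinuousOn.add (ContinuousOn.inv₀ (by fun_prop) ?_)
      continuousOn_const) fun s hs => (hpos s hs.1 i).ne'
    intro s hs
    linarith [hs.1]
  have hbound : k * ∑ i, ((1 + M)⁻¹ + d i)⁻¹ ≤ M := by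
    refine mul_le_mul_of_nonneg_left (Finset.sum_le_sum fun i _ => ?_) hk.le
    exact inv_anti₀ (hd i) (le_add_of_nonneg_left (by positivity))
  obtain ⟨s, hs, hs0⟩ := intermediate_value_Icc hM0 hcont
    ⟨by simpa using (hsum 0 le_rfl).le, sub_nonneg.2 hbound⟩
  have hs1 : s = k * ∑ i, ((1 + s)⁻¹ + d i)⁻¹ := sub_eq_zero.1 hs0
  have hs2 : 0 < s := hs1 ▸ hsum s hs.1
  refine ⟨s, ⟨hs2, hs1⟩, fun t ht => ?_⟩
  rcases lt_trichotomy t s with h | h | h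
  · exact absurd hs1 (hlt t s ht.1 h ht.2)
  · exact h
  · exact absurd ht.2 (hlt s t hs2 h hs1)

theorem stmt7 (p : ℕ) (hp : 0 < p)
    (Sig Q : Matrix (Fin p) (Fin p) ℝ)
    (hSig : Sig.PosDef) (hQ : Q.PosDef)
    (c z : ℝ) (hc : 0 < c) (hz : 0 ≤ z) :
    (∃! s : ℝ, 0 < s ∧
      s = c / (p : ℝ) *
        (Sig * ((1 + s)⁻¹ • Sig + Q + z • Sig)⁻¹).trace) ∧
    ∀ s : ℝ, 0 < s →
      s = c / (p : ℝ) * (Sig * ((1 + s)⁻¹ • Sig + Q + z • Sig)⁻¹).trace →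
      s ≤ c * (Sig.trace / (p : ℝ)) / lambdaMin hQ.1 := by
  have : Nonempty (Fin p) := ⟨⟨0, hp⟩⟩
  have hk : 0 < c / (p : ℝ) := div_pos hc (Nat.cast_pos.2 hp)
  obtain ⟨d, hd, htrace⟩ := hSig.exists_trace_mul_inv_eq_sum hQ
  have heq : ∀ s : ℝ, 0 < s → (Sig * ((1 + s)⁻¹ • Sig + Q + z • Sig)⁻¹).trace =
      ∑ i, ((1 + s)⁻¹ + (z + d i))⁻¹ := by
    intro s hs
    have : (1 + s)⁻¹ • Sig + Q + z • Sig = ((1 + s)⁻¹ + z) • Sig + Q := by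
      rw [add_smul]
      abel
    rw [this, htrace _ (by positivity)]
    simp only [add_assoc]
  refine ⟨?_, fun s hs hfs => ?_⟩
  · refine (existsUnique_congr fun s => and_congr_right fun hs => ?_).2
      (existsUnique_pos_eq_mul_sum_inv (d := fun i => z + d i)
        (fun i => add_pos_of_nonneg_of_pos hz (hd i)) hk)
    rw [heq s hs]
  · have hle : (Sig * ((1 + s)⁻¹ • Sig + Q + z • Sig)⁻¹).trace ≤ (Sig * Q⁻¹).trace := by
      have h0 := htrace 0 le_rfl
      rw [zero_smul, zero_add] at h0
      rw [heq s hs, h0]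
      refine Finset.sum_le_sum fun i _ => inv_anti₀ (by simpa using hd i) ?_
      have : 0 < (1 + s)⁻¹ := by positivity
      linarith
    calc s = c / (p : ℝ) * (Sig * ((1 + s)⁻¹ • Sig + Q + z • Sig)⁻¹).trace := hfs
      _ ≤ c / (p : ℝ) * (Sig.trace / lambdaMin hQ.1) :=
        mul_le_mul_of_nonneg_left (hle.trans (hSig.posSemidef.trace_mul_inv_le hQ)) hk.le
      _ = c * (Sig.trace / (p : ℝ)) / lambdaMin hQ.1 := by ring
end

section
/- Let p be a positive integer, Σ and Q be p × p real symmetric positive definite matrices, c > 0 and z ≥ 0. Let s₀ > 0 be the unique positive solution of s = (c/p)·tr[Σ·(Σ/(1+s) + Q + z·Σ)^{-1}], and set S = Σ/(1+s₀) + Q + z·Σ. Then there exists a unique real number s₁ satisfying s₁ = (s₁/(1+s₀)² − 1)·(c/p)·tr[Σ·S^{-1}·Σ·S^{-1}], and it satisfies −s₀·(1+s₀)² ≤ s₁ < 0. -/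
open Matrix Filter

/-- The trace of a product of two positive definite real matrices is positive. -/
theorem Matrix.PosDef.trace_mul_pos {n : Type*} [Fintype n] [Nonempty n]
    {A B : Matrix n n ℝ} (hA : A.PosDef) (hB : B.PosDef) : 0 < (A * B).trace := by
  classical
  open scoped MatrixOrder in
  obtain ⟨C, hC, rfl⟩ := CStarAlgebra.isStrictlyPositive_iff_eq_star_mul_self.mp
    hA.isStrictlyPositive
  rw [mul_assoc, Matrix.trace_mul_comm]
  exact ((Matrix.IsUnit.posDef_star_right_conjugate_iff hC).mpr hB).trace_pos

theorem trace_mul_inv_mul_mul_inv_pos {n : Type*} [Fintype n] [DecidableEq n] [Nonempty n]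
    {A S B : Matrix n n ℝ} (hA : A.PosDef) (hS : S.PosDef) (hB : B.PosDef) :
    0 < (A * S⁻¹ * B * S⁻¹).trace := by
  rw [show A * S⁻¹ * B * S⁻¹ = A * (S⁻¹ * B * S⁻¹) by simp only [mul_assoc]]
  refine hA.trace_mul_pos ?_
  have hconj := (Matrix.IsUnit.posDef_star_right_conjugate_iff hS.inv.isUnit).mpr hB
  rwa [Matrix.star_eq_conjTranspose, hS.inv.isHermitian.eq] at hconj

/-- The affine fixed-point equation `s = (s / (1 + a)² - 1) t` has exactly one solution when
`0 < t < (1 + a) a`, and this solution lies in `[-a (1 + a)², 0)`. -/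
theorem existsUnique_linear_fixed_point {a t : ℝ} (ha : 0 < a) (ht : 0 < t)
    (hta : t < (1 + a) * a) :
    (∃! s : ℝ, s = (s / (1 + a) ^ 2 - 1) * t) ∧
      ∀ s : ℝ, s = (s / (1 + a) ^ 2 - 1) * t → -a * (1 + a) ^ 2 ≤ s ∧ s < 0 := by
  have hsq : 0 < (1 + a) ^ 2 := by positivity
  have hgap : 1 + a < (1 + a) ^ 2 - t := by nlinarith
  have hgap_pos : 0 < (1 + a) ^ 2 - t := by linarith
  have hsolve (s : ℝ) : s = (s / (1 + a) ^ 2 - 1) * t ↔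
      s = -(t * (1 + a) ^ 2) / ((1 + a) ^ 2 - t) := by
    rw [eq_div_iff hgap_pos.ne']
    field_simp
    constructor <;> intro h <;> linarith
  simp only [hsolve]
  refine ⟨existsUnique_eq, ?_⟩
  rintro s rfl
  refine ⟨?_, div_neg_of_neg_of_pos (neg_neg_of_pos (mul_pos ht hsq)) hgap_pos⟩
  rw [le_div_iff₀ hgap_pos]
  have hle : t ≤ a * ((1 + a) ^ 2 - t) := by nlinarith
  nlinarith [mul_le_mul_of_nonneg_right hle hsq.le]

theorem stmt8 (p : ℕ) (hp : 0 < p)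
    (Sig Q : Matrix (Fin p) (Fin p) ℝ)
    (hSig : Sig.PosDef) (hQ : Q.PosDef)
    (c z : ℝ) (hc : 0 < c) (hz : 0 ≤ z)
    (s₀ : ℝ) (hs₀pos : 0 < s₀)
    (hs₀eq : s₀ = c / (p : ℝ) *
      (Sig * ((1 + s₀)⁻¹ • Sig + Q + z • Sig)⁻¹).trace) :
    (∃! s₁ : ℝ, s₁ = (s₁ / (1 + s₀) ^ 2 - 1) * (c / (p : ℝ)) *
      (Sig * ((1 + s₀)⁻¹ • Sig + Q + z • Sig)⁻¹ *
        Sig * ((1 + s₀)⁻¹ • Sig + Q + z • Sig)⁻¹).trace) ∧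
    ∀ s₁ : ℝ, s₁ = (s₁ / (1 + s₀) ^ 2 - 1) * (c / (p : ℝ)) *
      (Sig * ((1 + s₀)⁻¹ • Sig + Q + z • Sig)⁻¹ *
        Sig * ((1 + s₀)⁻¹ • Sig + Q + z • Sig)⁻¹).trace →
      -s₀ * (1 + s₀) ^ 2 ≤ s₁ ∧ s₁ < 0 := by
  have : Nonempty (Fin p) := ⟨⟨0, hp⟩⟩
  set S := (1 + s₀)⁻¹ • Sig + Q + z • Sig with hS
  have hSpos : S.PosDef :=
    ((hSig.smul (inv_pos.mpr (by linarith : 0 < 1 + s₀))).add hQ).add_posSemidef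
      (hSig.posSemidef.smul hz)
  have hdecomp : (Sig * S⁻¹).trace = (1 + s₀)⁻¹ * (Sig * S⁻¹ * Sig * S⁻¹).trace
      + (Sig * S⁻¹ * Q * S⁻¹).trace + z * (Sig * S⁻¹ * Sig * S⁻¹).trace := by
    have hcancel : Sig * S⁻¹ = Sig * S⁻¹ * S * S⁻¹ := by
      rw [Matrix.nonsing_inv_mul_cancel_right _ _
        ((Matrix.isUnit_iff_isUnit_det _).mp hSpos.isUnit)]
    calc (Sig * S⁻¹).trace = (Sig * S⁻¹ * S * S⁻¹).trace := by rw [← hcancel]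
      _ = (Sig * S⁻¹ * ((1 + s₀)⁻¹ • Sig + Q + z • Sig) * S⁻¹).trace := by rw [← hS]
      _ = _ := by
        simp only [Matrix.mul_add, Matrix.add_mul, Matrix.mul_smul, Matrix.smul_mul,
          Matrix.trace_add, Matrix.trace_smul, smul_eq_mul]
  have hSigTrace := trace_mul_inv_mul_mul_inv_pos hSig hSpos hSig
  have hQTrace := trace_mul_inv_mul_mul_inv_pos hSig hSpos hQ
  have hcp : 0 < c / (p : ℝ) := div_pos hc (by exact_mod_cast hp)
  simp only [mul_assoc (_ - _ : ℝ)]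
  refine existsUnique_linear_fixed_point hs₀pos (mul_pos hcp hSigTrace) ?_
  rw [hdecomp] at hs₀eq
  have hzTrace := mul_nonneg hcp.le (mul_nonneg hz hSigTrace.le)
  have hQTrace' := mul_pos hcp hQTrace
  rw [← div_lt_iff₀' (by linarith : 0 < 1 + s₀), div_eq_inv_mul]
  linarith
end

section
/- Let p be a positive integer, let Σ and Q be p × p real symmetric positive definite matrices with Q ⪯ C'·Σ in the Loewner order for a constant C' > 0, let s₀ > 0, and set S = Σ/(1+s₀) + Q. Then: (1) for every p × p real symmetric positive semidefinite matrix A, ((1+s₀)/(C'·(1+s₀)+1))·tr(S^{-1}A) ≤ tr(S^{-1}ΣS^{-1}A) ≤ (1+s₀)·tr(S^{-1}A); and (2) for every ξ ∈ ℝᵖ, (1/(1/(1+s₀) + C'))·ξᵀΣ^{-1}ξ ≤ ξᵀS^{-1}ξ ≤ (1+s₀)·ξᵀΣ^{-1}ξ. -/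
open Matrix Filter

namespace Matrix

variable {n : Type*} [Fintype n] [DecidableEq n]

open scoped MatrixOrder in
theorem PosSemidef.trace_mul_nonneg {A B : Matrix n n ℝ} (hA : A.PosSemidef)
    (hB : B.PosSemidef) : 0 ≤ (A * B).trace := by
  obtain ⟨X, rfl⟩ := CStarAlgebra.nonneg_iff_eq_star_mul_self.mp hB.nonneg
  rw [star_eq_conjTranspose, ← mul_assoc, trace_mul_comm, ← mul_assoc]
  exact (hA.mul_mul_conjTranspose_same X).trace_nonneg

/-- Inversion is antitone on positive definite matrices for the Loewner order. -/
theorem PosDef.posSemidef_inv_sub_inv {M N : Matrix n n ℝ} (hM : M.PosDef) (hN : N.PosDef)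
    (h : (N - M).PosSemidef) : (M⁻¹ - N⁻¹).PosSemidef := by
  have hMu := M.isUnit_iff_isUnit_det.mp hM.isUnit
  have hNu := N.isUnit_iff_isUnit_det.mp hN.isUnit
  have key : M⁻¹ - N⁻¹ =
      N⁻¹ * (N - M) * N⁻¹ + N⁻¹ * (N - M) * M⁻¹ * ((N - M) * N⁻¹) := by
    have h₁ : N⁻¹ * (N - M) * M⁻¹ = M⁻¹ - N⁻¹ := by
      rw [mul_sub, sub_mul, nonsing_inv_mul _ hNu, one_mul, mul_assoc, mul_nonsing_inv _ hMu,
        mul_one]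
    have h₂ : M⁻¹ * ((N - M) * N⁻¹) = M⁻¹ - N⁻¹ := by
      rw [sub_mul, mul_sub, mul_nonsing_inv _ hNu, mul_one, ← mul_assoc, nonsing_inv_mul _ hMu,
        one_mul]
    rw [h₁, sub_mul, h₂, ← mul_assoc]
    abel
  have hNi : N⁻¹ᴴ = N⁻¹ := hN.inv.isHermitian
  have hc : ((N - M) * N⁻¹)ᴴ = N⁻¹ * (N - M) := by
    rw [conjTranspose_mul, hNi, h.isHermitian.eq]
  rw [key]
  refine .add ?_ ?_
  · simpa only [hNi] using h.conjTranspose_mul_mul_same N⁻¹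
  · simpa only [hc] using hM.inv.posSemidef.conjTranspose_mul_mul_same ((N - M) * N⁻¹)

/-- If `M ⪯ c • N` then `N⁻¹ ⪯ c • M⁻¹`, as an inequality of quadratic forms. -/
theorem PosDef.dotProduct_inv_mulVec_le {M N : Matrix n n ℝ} (hM : M.PosDef) (hN : N.PosDef)
    {c : ℝ} (hc : 0 < c) (h : (c • N - M).PosSemidef) (x : n → ℝ) :
    x ⬝ᵥ (N⁻¹ *ᵥ x) ≤ c * (x ⬝ᵥ (M⁻¹ *ᵥ x)) := by
  have hx := (hM.posSemidef_inv_sub_inv (hN.smul hc) h).dotProduct_mulVec_nonneg x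
  have hinv : (c • N)⁻¹ = c⁻¹ • N⁻¹ :=
    inv_smul' N (Units.mk0 c hc.ne') (N.isUnit_iff_isUnit_det.mp hN.isUnit)
  rw [hinv, star_trivial, sub_mulVec, smul_mulVec, dotProduct_sub, dotProduct_smul, smul_eq_mul,
    sub_nonneg] at hx
  exact (inv_mul_le_iff₀ hc).mp hx

/-- If `M ⪯ c • N` then `tr (T * M * T * A) ≤ c * tr (T * N * T * A)` for Hermitian `T` and
positive semidefinite `A`. -/
theorem PosSemidef.trace_conj_mul_le {M N T A : Matrix n n ℝ} {c : ℝ}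
    (h : (c • N - M).PosSemidef) (hT : T.IsHermitian) (hA : A.PosSemidef) :
    (T * M * T * A).trace ≤ c * (T * N * T * A).trace := by
  have hTA := (h.conjTranspose_mul_mul_same T).trace_mul_nonneg hA
  rw [hT.eq, mul_sub, sub_mul, sub_mul, trace_sub, sub_nonneg] at hTA
  simpa using hTA

end Matrix

theorem stmt17 (p : ℕ) (hp : 0 < p)
    (Sig Q : Matrix (Fin p) (Fin p) ℝ)
    (hSig : Sig.PosDef) (hQ : Q.PosDef)
    (C' : ℝ) (hC' : 0 < C')
    (hQle : (C' • Sig - Q).PosSemidef)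
    (s₀ : ℝ) (hs₀ : 0 < s₀) :
    (∀ A : Matrix (Fin p) (Fin p) ℝ, A.PosSemidef →
      ((1 + s₀) / (C' * (1 + s₀) + 1)) *
          (((1 + s₀)⁻¹ • Sig + Q)⁻¹ * A).trace ≤
        (((1 + s₀)⁻¹ • Sig + Q)⁻¹ * Sig * ((1 + s₀)⁻¹ • Sig + Q)⁻¹ * A).trace ∧
      (((1 + s₀)⁻¹ • Sig + Q)⁻¹ * Sig * ((1 + s₀)⁻¹ • Sig + Q)⁻¹ * A).trace ≤
        (1 + s₀) * (((1 + s₀)⁻¹ • Sig + Q)⁻¹ * A).trace) ∧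
    (∀ ξ : Fin p → ℝ,
      (1 / ((1 + s₀)⁻¹ + C')) * (ξ ⬝ᵥ (Sig⁻¹ *ᵥ ξ)) ≤
        ξ ⬝ᵥ (((1 + s₀)⁻¹ • Sig + Q)⁻¹ *ᵥ ξ) ∧
      ξ ⬝ᵥ (((1 + s₀)⁻¹ • Sig + Q)⁻¹ *ᵥ ξ) ≤
        (1 + s₀) * (ξ ⬝ᵥ (Sig⁻¹ *ᵥ ξ))) := by
  have ht : 0 < 1 + s₀ := by linarith
  have hc : 0 < (1 + s₀)⁻¹ + C' := by positivity
  have hS : ((1 + s₀)⁻¹ • Sig + Q).PosDef := (hSig.smul (inv_pos.mpr ht)).add hQ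
  have hS_le : (((1 + s₀)⁻¹ + C') • Sig - ((1 + s₀)⁻¹ • Sig + Q)).PosSemidef := by
    rwa [add_smul, add_sub_add_left_eq_sub]
  have hSig_le : ((1 + s₀) • ((1 + s₀)⁻¹ • Sig + Q) - Sig).PosSemidef := by
    rw [smul_add, smul_inv_smul₀ ht.ne', add_sub_cancel_left]
    exact hQ.posSemidef.smul ht.le
  have hconst : (1 + s₀) / (C' * (1 + s₀) + 1) = ((1 + s₀)⁻¹ + C')⁻¹ := by
    field_simp
    ring
  set S := (1 + s₀)⁻¹ • Sig + Q
  have hSS : S⁻¹ * S * S⁻¹ = S⁻¹ := by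
    rw [nonsing_inv_mul _ (S.isUnit_iff_isUnit_det.mp hS.isUnit), one_mul]
  have hSi := hS.inv.isHermitian
  refine ⟨fun A hA => ⟨?_, ?_⟩, fun ξ => ⟨?_, hSig.dotProduct_inv_mulVec_le hS ht hSig_le ξ⟩⟩
  · rw [hconst, inv_mul_le_iff₀ hc]
    simpa only [hSS] using hS_le.trace_conj_mul_le hSi hA
  · simpa only [hSS] using hSig_le.trace_conj_mul_le hSi hA
  · rw [one_div, inv_mul_le_iff₀ hc]
    exact hS.dotProduct_inv_mulVec_le hSig hc hS_le ξ
end
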